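/- For every ξ = (ξ₀,ξ₁,ξ₂,ξ₃) ∈ ℝ⁴ with (ξ₁,ξ₂,ξ₃) ≠ (0,0,0) and every f = (f₁,f₂,f₃) ∈ ℂ³, the vector Y₁(ξ,f) ∈ ℂ^55 satisfies B(ξ)·Y₁(ξ,f) = G(ξ,f). -/

import Mathlib

open Matrix Complex

/-- `e i` is the `i`-th standard basis vector of `ℂ^55` (`1 ≤ i ≤ 55`, one-based). -/
def e (i : ℕ) : Fin 55 → ℂ := fun j => if (j : ℕ) + 1 = i then 1 else 0

def α₁ : Fin 55 → ℂ := e 5 + e 10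
def α₂ (μ τ : ℝ) : Fin 55 → ℂ :=
  (τ : ℂ) • e 13 - (μ : ℂ) • (e 18 + e 19 + e 20) + e 47 + e 48 + e 49
def α₃ (μ τ : ℝ) : Fin 55 → ℂ :=
  (τ : ℂ) • e 14 - (μ : ℂ) • (e 28 + e 29 + e 30) + e 50 + e 51 + e 52
def α₄ (μ τ : ℝ) : Fin 55 → ℂ :=
  (τ : ℂ) • e 15 - (μ : ℂ) • (e 38 + e 39 + e 40) + e 53 + e 54 + e 55

/-- The `16 × 55` matrix `H`. -/
def Hm (μ τ : ℝ) : Matrix (Fin 16) (Fin 55) ℂ :=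
  Matrix.of ![-α₁, -α₂ μ τ, -α₃ μ τ, -α₄ μ τ, e 1, e 2, e 3, e 4, e 5, e 6, e 7, e 8,
    e 9, e 10, e 11, e 16]

/-- The `16 × 55` matrix `H₀`. -/
def Hm0 (μ τ : ℝ) : Matrix (Fin 16) (Fin 55) ℂ :=
  Matrix.of ![e 21, e 17, e 27, e 37, e 22, e 23, -α₂ μ τ, e 31, e 32, e 33, -α₃ μ τ,
    e 41, e 42, e 43, -α₄ μ τ, e 12]

/-- The `16 × 55` matrix `H₁`. -/
def Hm1 : Matrix (Fin 16) (Fin 55) ℂ :=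
  Matrix.of ![e 18, e 21, e 31, e 41, e 24, e 25, -α₁, e 28, e 34, e 35, e 4, e 38,
    e 44, e 45, e 8, e 13]

/-- The `16 × 55` matrix `H₂`. -/
def Hm2 : Matrix (Fin 16) (Fin 55) ℂ :=
  Matrix.of ![e 24, e 22, e 32, e 42, e 19, e 26, e 1, e 34, e 29, e 36, e 5, e 44,
    e 39, e 46, e 9, e 14]

/-- The `16 × 55` matrix `H₃`. -/
def Hm3 : Matrix (Fin 16) (Fin 55) ℂ :=
  Matrix.of ![e 25, e 23, e 33, e 43, e 26, e 20, e 2, e 35, e 36, e 30, e 6, e 45,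
    e 46, e 40, e 10, e 15]

/-- The four matrices `H₀, H₁, H₂, H₃`. -/
def HmB (μ τ : ℝ) : Fin 4 → Matrix (Fin 16) (Fin 55) ℂ := ![Hm0 μ τ, Hm1, Hm2, Hm3]

/-- The `64 × 55` complex matrix `B(ξ)`, obtained by stacking the four `16 × 55` blocks
`iξ₀H − H₀`, `iξ₁H − H₁`, `iξ₂H − H₂`, `iξ₃H − H₃`. -/
noncomputable def B (μ τ : ℝ) (ξ : Fin 4 → ℝ) : Matrix (Fin 64) (Fin 55) ℂ :=
  Matrix.of fun i j =>
    Complex.I * (ξ ⟨(i : ℕ) / 16, by have := i.isLt; omega⟩ : ℂ) *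
        Hm μ τ ⟨(i : ℕ) % 16, by have := i.isLt; omega⟩ j
      - HmB μ τ ⟨(i : ℕ) / 16, by have := i.isLt; omega⟩
          ⟨(i : ℕ) % 16, by have := i.isLt; omega⟩ j

/-- `a(ξ) = (μ((iξ₁)² + (iξ₂)² + (iξ₃)²) − iξ₀)/τ`. -/
noncomputable def aC (μ τ : ℝ) (ξ : Fin 4 → ℝ) : ℂ :=
  ((μ : ℂ) * ((Complex.I * ξ 1) ^ 2 + (Complex.I * ξ 2) ^ 2 + (Complex.I * ξ 3) ^ 2)
    - Complex.I * ξ 0) / (τ : ℂ)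

/-- `b(ξ) = ((iξ₁)² + (iξ₂)² + (iξ₃)²)/a(ξ)`. -/
noncomputable def bC (μ τ : ℝ) (ξ : Fin 4 → ℝ) : ℂ :=
  ((Complex.I * ξ 1) ^ 2 + (Complex.I * ξ 2) ^ 2 + (Complex.I * ξ 3) ^ 2) / aC μ τ ξ

/-- The vector `Y(y₃, y₇, y₁₁, y₁₆, w) ∈ ℂ^55`. -/
noncomputable def Yv (ξ : Fin 4 → ℝ) (y3 y7 y11 y16 : ℂ) (w : Fin 9 → ℂ) : Fin 55 → ℂ :=
  let z : Fin 4 → ℂ := fun k => Complex.I * ξ k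
  ![z 2 * y3, z 3 * y3, y3,
    z 1 * y7, z 2 * y7, z 3 * y7, y7,
    z 1 * y11, z 2 * y11, z 3 * y11, y11,
    z 0 * y16, z 1 * y16, z 2 * y16, z 3 * y16, y16,
    (z 0) ^ 2 * y3, (z 1) ^ 2 * y3, (z 2) ^ 2 * y3, (z 3) ^ 2 * y3,
    z 0 * z 1 * y3, z 0 * z 2 * y3, z 0 * z 3 * y3,
    z 1 * z 2 * y3, z 1 * z 3 * y3, z 2 * z 3 * y3,
    (z 0) ^ 2 * y7, (z 1) ^ 2 * y7, (z 2) ^ 2 * y7, (z 3) ^ 2 * y7,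
    z 0 * z 1 * y7, z 0 * z 2 * y7, z 0 * z 3 * y7,
    z 1 * z 2 * y7, z 1 * z 3 * y7, z 2 * z 3 * y7,
    (z 0) ^ 2 * y11, (z 1) ^ 2 * y11, (z 2) ^ 2 * y11, (z 3) ^ 2 * y11,
    z 0 * z 1 * y11, z 0 * z 2 * y11, z 0 * z 3 * y11,
    z 1 * z 2 * y11, z 1 * z 3 * y11, z 2 * z 3 * y11,
    w 0, w 1, w 2, w 3, w 4, w 5, w 6, w 7, w 8]

/-- `ê j` is the `j`-th standard basis vector of `ℂ⁹`. -/
def eh (j : Fin 9) : Fin 9 → ℂ := fun k => if k = j then 1 else 0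

/-- The nine null-space vectors `η₁(ξ), …, η₉(ξ)` (indexed by `Fin 9`, zero-based). -/
noncomputable def ηv (μ τ : ℝ) (ξ : Fin 4 → ℝ) (j : Fin 9) : Fin 55 → ℂ :=
  let a := aC μ τ ξ
  let b := bC μ τ ξ
  let D := a ^ 2 * b * (τ : ℂ)
  if (j : ℕ) < 3 then
    Yv ξ ((ξ 1 : ℂ) ^ 2 / D + 1 / (a * τ)) ((ξ 1 : ℂ) * (ξ 2 : ℂ) / D)
      ((ξ 1 : ℂ) * (ξ 3 : ℂ) / D) (-(Complex.I * ξ 1) / (a * b * τ)) (eh j)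
  else if (j : ℕ) < 6 then
    Yv ξ ((ξ 1 : ℂ) * (ξ 2 : ℂ) / D) ((ξ 2 : ℂ) ^ 2 / D + 1 / (a * τ))
      ((ξ 2 : ℂ) * (ξ 3 : ℂ) / D) (-(Complex.I * ξ 2) / (a * b * τ)) (eh j)
  else
    Yv ξ ((ξ 1 : ℂ) * (ξ 3 : ℂ) / D) ((ξ 2 : ℂ) * (ξ 3 : ℂ) / D)
      ((ξ 3 : ℂ) ^ 2 / D + 1 / (a * τ)) (-(Complex.I * ξ 3) / (a * b * τ)) (eh j)

/-- The particular solution `Y₁(ξ, f)`. -/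
noncomputable def Y1 (μ τ : ℝ) (ξ : Fin 4 → ℝ) (f : Fin 3 → ℂ) : Fin 55 → ℂ :=
  let a := aC μ τ ξ
  let b := bC μ τ ξ
  let D := a ^ 2 * b * (τ : ℂ)
  let S := Complex.I * ξ 1 * f 0 + Complex.I * ξ 2 * f 1 + Complex.I * ξ 3 * f 2
  Yv ξ (Complex.I * ξ 1 * S / D - f 0 / (a * τ)) (Complex.I * ξ 2 * S / D - f 1 / (a * τ))
    (Complex.I * ξ 3 * S / D - f 2 / (a * τ)) (S / (a * b * τ)) 0

/-- The right-hand side `G(ξ, f) ∈ ℂ⁶⁴`: the stack of the four `16`-blocks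
`g⁰(f) − iξ₀ g¹(f)`, `−iξ₁ g¹(f)`, `−iξ₂ g¹(f)`, `−iξ₃ g¹(f)`. -/
noncomputable def Gv (ξ : Fin 4 → ℝ) (f : Fin 3 → ℂ) : Fin 64 → ℂ := fun i =>
  let g1 : Fin 16 → ℂ := ![0, f 0, f 1, f 2, 0, 0, 0, 0, 0, 0, 0, 0, 0, 0, 0, 0]
  let g0 : Fin 16 → ℂ := ![0, 0, 0, 0, 0, 0, f 0, 0, 0, 0, f 1, 0, 0, 0, f 2, 0]
  if h : (i : ℕ) < 16 then
    g0 ⟨(i : ℕ), h⟩ - Complex.I * ξ 0 * g1 ⟨(i : ℕ), h⟩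
  else
    -(Complex.I * (ξ ⟨(i : ℕ) / 16, by have := i.isLt; omega⟩ : ℂ)) *
      g1 ⟨(i : ℕ) % 16, by have := i.isLt; omega⟩

theorem e_dot (i : ℕ) (hi : i < 55) (v : Fin 55 → ℂ) : e (i + 1) ⬝ᵥ v = v ⟨i, hi⟩ := by
  unfold e dotProduct
  rw [Finset.sum_eq_single (⟨i, hi⟩ : Fin 55)]
  · simp
  · intro j _ hj
    have : ¬ ((j : ℕ) + 1 = i + 1) := fun h => hj (Fin.ext (by simpa using h))
    change (if (j : ℕ) + 1 = i + 1 then (1 : ℂ) else 0) * v j = 0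
    rw [if_neg this, zero_mul]
  · simp

/-- Product of `B` with a vector, in terms of the rows of the blocks. -/
theorem B_row (μ τ : ℝ) (ξ : Fin 4 → ℝ) (v : Fin 55 → ℂ) (k : Fin 4) (r : Fin 16)
    (i : Fin 64) (hk : (i : ℕ) / 16 = k) (hr : (i : ℕ) % 16 = r) :
    (B μ τ ξ).mulVec v i = Complex.I * ξ k * (Hm μ τ r ⬝ᵥ v) - HmB μ τ k r ⬝ᵥ v := by
  obtain ⟨k, hk'⟩ := k
  obtain ⟨r, hr'⟩ := r
  simp only at hk hr
  subst hk hr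
  simp only [Matrix.mulVec, B, dotProduct, Matrix.of_apply, Finset.mul_sum,
    ← Finset.sum_sub_distrib]
  exact Finset.sum_congr rfl fun j _ => by ring

theorem G_row (ξ : Fin 4 → ℝ) (f : Fin 3 → ℂ) (k : Fin 4) (r : Fin 16)
    (i : Fin 64) (hk : (i : ℕ) / 16 = k) (hr : (i : ℕ) % 16 = r) :
    Gv ξ f i = (if k = 0 then
      (![0, 0, 0, 0, 0, 0, f 0, 0, 0, 0, f 1, 0, 0, 0, f 2, 0] : Fin 16 → ℂ) r else 0)
      - Complex.I * ξ k *
        (![0, f 0, f 1, f 2, 0, 0, 0, 0, 0, 0, 0, 0, 0, 0, 0, 0] : Fin 16 → ℂ) r := by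
  obtain ⟨k, hk'⟩ := k
  obtain ⟨r, hr'⟩ := r
  simp only at hk hr
  subst hk hr
  unfold Gv
  by_cases h : (i : ℕ) < 16
  · have h0 : (i : ℕ) / 16 = 0 := by omega
    have h1 : (i : ℕ) % 16 = i := by omega
    simp only [h, h0, h1, dite_true, Fin.zero_eta, if_true]
  · have h0 : ¬ (i : ℕ) / 16 = 0 := by omega
    have h2 : ¬ ((⟨(i : ℕ) / 16, hk'⟩ : Fin 4) = 0) := fun h => h0 (by simpa using congrArg Fin.val h)
    simp only [h, dite_false, if_neg h2]
    ring

set_option maxHeartbeats 1000000 in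
theorem main_general (μ τ : ℝ) (ξ : Fin 4 → ℝ) (f : Fin 3 → ℂ) (y3 y7 y11 y16 : ℂ)
    (hdiv : I * ξ 1 * y3 + I * ξ 2 * y7 + I * ξ 3 * y11 = 0)
    (h1 : τ * (I * ξ 1 * y16) - μ * (((I * ξ 1) ^ 2 + (I * ξ 2) ^ 2 + (I * ξ 3) ^ 2) * y3)
      + I * ξ 0 * y3 = f 0)
    (h2 : τ * (I * ξ 2 * y16) - μ * (((I * ξ 1) ^ 2 + (I * ξ 2) ^ 2 + (I * ξ 3) ^ 2) * y7)
      + I * ξ 0 * y7 = f 1)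
    (h3 : τ * (I * ξ 3 * y16) - μ * (((I * ξ 1) ^ 2 + (I * ξ 2) ^ 2 + (I * ξ 3) ^ 2) * y11)
      + I * ξ 0 * y11 = f 2) :
    (B μ τ ξ).mulVec (Yv ξ y3 y7 y11 y16 0) = Gv ξ f := by
  set Y := Yv ξ y3 y7 y11 y16 0 with hY
  have a1 : α₁ ⬝ᵥ Y = -(I * ξ 1 * y3) := by
    simp only [α₁, add_dotProduct, e_dot _ (by norm_num : 4 < 55), e_dot _ (by norm_num : 9 < 55)]
    change I * ξ 2 * y7 + I * ξ 3 * y11 = _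
    linear_combination hdiv
  have a2 : α₂ μ τ ⬝ᵥ Y = f 0 - I * ξ 0 * y3 := by
    simp only [α₂, add_dotProduct, sub_dotProduct, smul_dotProduct, smul_eq_mul,
      e_dot 12 (by norm_num), e_dot 17 (by norm_num), e_dot 18 (by norm_num),
      e_dot 19 (by norm_num), e_dot 46 (by norm_num), e_dot 47 (by norm_num),
      e_dot 48 (by norm_num)]
    change τ * (I * ξ 1 * y16) - μ * ((I * ξ 1) ^ 2 * y3 + (I * ξ 2) ^ 2 * y3
      + (I * ξ 3) ^ 2 * y3) + 0 + 0 + 0 = _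
    linear_combination h1
  have a3 : α₃ μ τ ⬝ᵥ Y = f 1 - I * ξ 0 * y7 := by
    simp only [α₃, add_dotProduct, sub_dotProduct, smul_dotProduct, smul_eq_mul,
      e_dot 13 (by norm_num), e_dot 27 (by norm_num), e_dot 28 (by norm_num),
      e_dot 29 (by norm_num), e_dot 49 (by norm_num), e_dot 50 (by norm_num),
      e_dot 51 (by norm_num)]
    change τ * (I * ξ 2 * y16) - μ * ((I * ξ 1) ^ 2 * y7 + (I * ξ 2) ^ 2 * y7
      + (I * ξ 3) ^ 2 * y7) + 0 + 0 + 0 = _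
    linear_combination h2
  have a4 : α₄ μ τ ⬝ᵥ Y = f 2 - I * ξ 0 * y11 := by
    simp only [α₄, add_dotProduct, sub_dotProduct, smul_dotProduct, smul_eq_mul,
      e_dot 14 (by norm_num), e_dot 37 (by norm_num), e_dot 38 (by norm_num),
      e_dot 39 (by norm_num), e_dot 52 (by norm_num), e_dot 53 (by norm_num),
      e_dot 54 (by norm_num)]
    change τ * (I * ξ 3 * y16) - μ * ((I * ξ 1) ^ 2 * y11 + (I * ξ 2) ^ 2 * y11
      + (I * ξ 3) ^ 2 * y11) + 0 + 0 + 0 = _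
    linear_combination h3
  have N1 : (-α₁) ⬝ᵥ Y = I * ξ 1 * y3 := by rw [neg_dotProduct, a1, neg_neg]
  have N2 : (-α₂ μ τ) ⬝ᵥ Y = I * ξ 0 * y3 - f 0 := by rw [neg_dotProduct, a2, neg_sub]
  have N3 : (-α₃ μ τ) ⬝ᵥ Y = I * ξ 0 * y7 - f 1 := by rw [neg_dotProduct, a3, neg_sub]
  have N4 : (-α₄ μ τ) ⬝ᵥ Y = I * ξ 0 * y11 - f 2 := by rw [neg_dotProduct, a4, neg_sub]
  have E : ∀ i : Fin 55, e ((i : ℕ) + 1) ⬝ᵥ Y = Y i := fun i => e_dot i i.isLt Y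
  -- the products of the rows of the five blocks with `Y`
  have hH : ∀ r, Hm μ τ r ⬝ᵥ Y = (![I * ξ 1 * y3, I * ξ 0 * y3 - f 0, I * ξ 0 * y7 - f 1,
      I * ξ 0 * y11 - f 2, I * ξ 2 * y3, I * ξ 3 * y3, y3, I * ξ 1 * y7, I * ξ 2 * y7,
      I * ξ 3 * y7, y7, I * ξ 1 * y11, I * ξ 2 * y11, I * ξ 3 * y11, y11, y16] :
      Fin 16 → ℂ) r := by
    intro r
    fin_cases r
    exacts [N1, N2, N3, N4, E 0, E 1, E 2, E 3,
      E 4, E 5, E 6, E 7, E 8, E 9, E 10, E 15]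
  have hH0 : ∀ r, HmB μ τ 0 r ⬝ᵥ Y = (![I * ξ 0 * (I * ξ 1) * y3, (I * ξ 0) ^ 2 * y3,
      (I * ξ 0) ^ 2 * y7, (I * ξ 0) ^ 2 * y11, I * ξ 0 * (I * ξ 2) * y3,
      I * ξ 0 * (I * ξ 3) * y3, I * ξ 0 * y3 - f 0, I * ξ 0 * (I * ξ 1) * y7,
      I * ξ 0 * (I * ξ 2) * y7, I * ξ 0 * (I * ξ 3) * y7, I * ξ 0 * y7 - f 1,
      I * ξ 0 * (I * ξ 1) * y11, I * ξ 0 * (I * ξ 2) * y11, I * ξ 0 * (I * ξ 3) * y11,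
      I * ξ 0 * y11 - f 2, I * ξ 0 * y16] : Fin 16 → ℂ) r := by
    intro r
    fin_cases r
    exacts [E 20, E 16, E 26, E 36, E 21, E 22, N2, E 30,
      E 31, E 32, N3, E 40, E 41, E 42, N4, E 11]
  have hH1 : ∀ r, HmB μ τ 1 r ⬝ᵥ Y = (![(I * ξ 1) ^ 2 * y3, I * ξ 0 * (I * ξ 1) * y3,
      I * ξ 0 * (I * ξ 1) * y7, I * ξ 0 * (I * ξ 1) * y11, I * ξ 1 * (I * ξ 2) * y3,
      I * ξ 1 * (I * ξ 3) * y3, I * ξ 1 * y3, (I * ξ 1) ^ 2 * y7,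
      I * ξ 1 * (I * ξ 2) * y7, I * ξ 1 * (I * ξ 3) * y7, I * ξ 1 * y7,
      (I * ξ 1) ^ 2 * y11, I * ξ 1 * (I * ξ 2) * y11, I * ξ 1 * (I * ξ 3) * y11,
      I * ξ 1 * y11, I * ξ 1 * y16] : Fin 16 → ℂ) r := by
    intro r
    fin_cases r
    exacts [E 17, E 20, E 30, E 40, E 23, E 24, N1, E 27,
      E 33, E 34, E 3, E 37, E 43, E 44, E 7, E 12]
  have hH2 : ∀ r, HmB μ τ 2 r ⬝ᵥ Y = (![I * ξ 1 * (I * ξ 2) * y3, I * ξ 0 * (I * ξ 2) * y3,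
      I * ξ 0 * (I * ξ 2) * y7, I * ξ 0 * (I * ξ 2) * y11, (I * ξ 2) ^ 2 * y3,
      I * ξ 2 * (I * ξ 3) * y3, I * ξ 2 * y3, I * ξ 1 * (I * ξ 2) * y7,
      (I * ξ 2) ^ 2 * y7, I * ξ 2 * (I * ξ 3) * y7, I * ξ 2 * y7,
      I * ξ 1 * (I * ξ 2) * y11, (I * ξ 2) ^ 2 * y11, I * ξ 2 * (I * ξ 3) * y11,
      I * ξ 2 * y11, I * ξ 2 * y16] : Fin 16 → ℂ) r := by
    intro r
    fin_cases r
    exacts [E 23, E 21, E 31, E 41, E 18, E 25, E 0, E 33,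
      E 28, E 35, E 4, E 43, E 38, E 45, E 8, E 13]
  have hH3 : ∀ r, HmB μ τ 3 r ⬝ᵥ Y = (![I * ξ 1 * (I * ξ 3) * y3, I * ξ 0 * (I * ξ 3) * y3,
      I * ξ 0 * (I * ξ 3) * y7, I * ξ 0 * (I * ξ 3) * y11, I * ξ 2 * (I * ξ 3) * y3,
      (I * ξ 3) ^ 2 * y3, I * ξ 3 * y3, I * ξ 1 * (I * ξ 3) * y7,
      I * ξ 2 * (I * ξ 3) * y7, (I * ξ 3) ^ 2 * y7, I * ξ 3 * y7,
      I * ξ 1 * (I * ξ 3) * y11, I * ξ 2 * (I * ξ 3) * y11, (I * ξ 3) ^ 2 * y11,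
      I * ξ 3 * y11, I * ξ 3 * y16] : Fin 16 → ℂ) r := by
    intro r
    fin_cases r
    exacts [E 24, E 22, E 32, E 42, E 25, E 19, E 1, E 34,
      E 35, E 29, E 5, E 44, E 45, E 39, E 9, E 14]
  funext i
  obtain ⟨k, hk⟩ : ∃ k : Fin 4, (i : ℕ) / 16 = k := ⟨⟨(i : ℕ) / 16, by omega⟩, rfl⟩
  obtain ⟨r, hr⟩ : ∃ r : Fin 16, (i : ℕ) % 16 = r := ⟨⟨(i : ℕ) % 16, by omega⟩, rfl⟩
  rw [B_row μ τ ξ Y k r i hk hr, G_row ξ f k r i hk hr, hH]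
  clear hk hr
  have hk : k = 0 ∨ k = 1 ∨ k = 2 ∨ k = 3 := by fin_cases k <;> simp
  rcases hk with rfl | rfl | rfl | rfl
  · rw [hH0, if_pos rfl]
    fin_cases r <;> simp <;> ring
  · rw [hH1, if_neg (by decide)]
    fin_cases r <;> simp <;> ring
  · rw [hH2, if_neg (by decide)]
    fin_cases r <;> simp <;> ring
  · rw [hH3, if_neg (by decide)]
    fin_cases r <;> simp <;> ring

/-- For every `ξ ∈ ℝ⁴` with `(ξ₁, ξ₂, ξ₃) ≠ (0,0,0)` and every
`f = (f₁, f₂, f₃) ∈ ℂ³`, the vector `Y₁(ξ, f) ∈ ℂ^55` satisfies `B(ξ) · Y₁(ξ, f) = G(ξ, f)`. -/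
theorem stmt6 (μ τ : ℝ) (hμ : 0 < μ) (hτ : 0 < τ)
    (ξ : Fin 4 → ℝ) (hξ : ¬(ξ 1 = 0 ∧ ξ 2 = 0 ∧ ξ 3 = 0)) (f : Fin 3 → ℂ) :
    (B μ τ ξ).mulVec (Y1 μ τ ξ f) = Gv ξ f := by
  have hτ' : (τ : ℂ) ≠ 0 := by exact_mod_cast hτ.ne'
  have hpos : 0 < ξ 1 ^ 2 + ξ 2 ^ 2 + ξ 3 ^ 2 := by
    rcases lt_or_eq_of_le (by positivity : 0 ≤ ξ 1 ^ 2 + ξ 2 ^ 2 + ξ 3 ^ 2) with h | h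
    · exact h
    · exact absurd ⟨by nlinarith [sq_nonneg (ξ 1), sq_nonneg (ξ 2), sq_nonneg (ξ 3)],
        by nlinarith [sq_nonneg (ξ 1), sq_nonneg (ξ 2), sq_nonneg (ξ 3)],
        by nlinarith [sq_nonneg (ξ 1), sq_nonneg (ξ 2), sq_nonneg (ξ 3)]⟩ hξ
  have hL' : (I * ξ 1) ^ 2 + (I * ξ 2) ^ 2 + (I * ξ 3) ^ 2
      = ((-(ξ 1 ^ 2 + ξ 2 ^ 2 + ξ 3 ^ 2) : ℝ) : ℂ) := by
    push_cast
    linear_combination ((ξ 1 : ℂ) ^ 2 + (ξ 2 : ℂ) ^ 2 + (ξ 3 : ℂ) ^ 2) * I_sq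
  have hL : (I * ξ 1) ^ 2 + (I * ξ 2) ^ 2 + (I * ξ 3) ^ 2 ≠ (0 : ℂ) := by
    rw [hL']
    exact_mod_cast (neg_lt_zero.mpr hpos).ne
  have ha : aC μ τ ξ ≠ 0 := by
    unfold aC
    refine div_ne_zero ?_ hτ'
    rw [hL']
    intro h
    have h' := congrArg Complex.re h
    have : 0 < μ * (ξ 1 ^ 2 + ξ 2 ^ 2 + ξ 3 ^ 2) := mul_pos hμ hpos
    rw [← Complex.ofReal_mul] at h'
    simp only [sub_re, ofReal_re, mul_re, I_re, I_im, ofReal_im, zero_re] at h'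
    linarith
  have hb : aC μ τ ξ * bC μ τ ξ = (I * ξ 1) ^ 2 + (I * ξ 2) ^ 2 + (I * ξ 3) ^ 2 := by
    unfold bC
    field_simp
  have haτ : aC μ τ ξ * τ = μ * ((I * ξ 1) ^ 2 + (I * ξ 2) ^ 2 + (I * ξ 3) ^ 2) - I * ξ 0 := by
    unfold aC
    field_simp
  have hb0 : bC μ τ ξ ≠ 0 := by
    intro h
    rw [h, mul_zero] at hb
    exact hL hb.symm
  unfold Y1
  simp only []
  generalize aC μ τ ξ = a at *
  generalize bC μ τ ξ = b at *
  -- each momentum equation, in a common form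
  have key : ∀ z g S : ℂ, τ * (z * (S / (a * b * τ)))
      - μ * (((I * ξ 1) ^ 2 + (I * ξ 2) ^ 2 + (I * ξ 3) ^ 2)
        * (z * S / (a ^ 2 * b * τ) - g / (a * τ)))
      + I * ξ 0 * (z * S / (a ^ 2 * b * τ) - g / (a * τ)) = g := by
    intro z g S
    have h1 : τ * (z * (S / (a * b * τ))) - a * τ * (z * S / (a ^ 2 * b * τ) - g / (a * τ))
        = g := by
      field_simp
      ring
    rw [haτ] at h1
    rw [haτ]
    linear_combination h1
  apply main_general
  · set S := I * ξ 1 * f 0 + I * ξ 2 * f 1 + I * ξ 3 * f 2 with hS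
    have : ((I * ξ 1) ^ 2 + (I * ξ 2) ^ 2 + (I * ξ 3) ^ 2) * S / (a ^ 2 * b * τ)
        - S / (a * τ) = 0 := by
      rw [← hb]
      field_simp
      ring
    rw [← this]
    conv_rhs => rw [sub_eq_add_neg, ← neg_div]
    rw [show -S / (a * τ) = -(I * ξ 1 * f 0 + I * ξ 2 * f 1 + I * ξ 3 * f 2) / (a * τ) by rw [hS]]
    ring
  · exact key _ _ _
  · exact key _ _ _
  · exact key _ _ _
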